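/- arXiv:2410.12612 — 7 statements merged into one kernel-verified Lean document; each statement's English description precedes it below -/
import Mathlib

section
/- Let σ > 0, γ ∈ ℝ, and let m be a positive integer with 2σm² - γ²m + 2(γ² - σ) > 0 and such that (γ² - σ)/(σm²) is not a positive integer. Then for every integer k ≥ 2 and for either choice of sign, det M_{km}(c_m^±(σ,γ), σ, γ) ≠ 0. -/
/-- The symbol matrix on the `n`-th Fourier mode of the linearization of the
vortex-sheet functional at the circular solution. -/
noncomputable def Mmat (n : ℕ) (c σ γ : ℝ) : Matrix (Fin 2) (Fin 2) ℝ :=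
  !![-(c + γ / 2) * n, (n : ℝ) / 2;
     σ - γ ^ 2 + γ ^ 2 / 2 * n - σ * n ^ 2, (c + γ / 2) * n]

/-- At the speed `c` with `(c + γ/2)² = (2σm - γ² + 2(γ²-σ)/m)/4`, the determinant of the symbol
on the mode `km` factors explicitly. -/
theorem det_Mmat_mul {m : ℕ} (hm : m ≠ 0) (k : ℕ) {c σ γ : ℝ}
    (hc : (c + γ / 2) ^ 2 = (2 * σ * m - γ ^ 2 + 2 * (γ ^ 2 - σ) / m) / 4) :
    (Mmat (k * m) c σ γ).det =
      -(k * m * (k - 1) * (γ ^ 2 - σ - k * (σ * (m : ℝ) ^ 2))) / 2 := by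
  have hm' : (m : ℝ) ≠ 0 := Nat.cast_ne_zero.mpr hm
  have hcm : (c + γ / 2) ^ 2 * m =
      (2 * σ * (m : ℝ) ^ 2 - γ ^ 2 * m + 2 * (γ ^ 2 - σ)) / 4 := by
    rw [hc]
    field_simp
  rw [Mmat, Matrix.det_fin_two_of]
  push_cast
  linear_combination -(k : ℝ) ^ 2 * m * hcm

/-- Absence of spectral collisions: if `2σm² - γ²m + 2(γ² - σ) > 0` and
`(γ² - σ)/(σm²)` is not a positive integer, then for every `k ≥ 2` and either
choice of sign `ε = ±1`, `det M_{km}(c_m^±(σ,γ), σ, γ) ≠ 0`, where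
`c_m^±(σ,γ) = -γ/2 ± (1/2)√(2σm - γ² + 2(γ²-σ)/m)`. -/
theorem no_spectral_collision_c (σ γ : ℝ) (hσ : 0 < σ) (m : ℕ) (hm : 0 < m)
    (hq : 0 < 2 * σ * (m : ℝ) ^ 2 - γ ^ 2 * (m : ℝ) + 2 * (γ ^ 2 - σ))
    (hno : ¬ ∃ j : ℕ, 0 < j ∧ (γ ^ 2 - σ) / (σ * (m : ℝ) ^ 2) = (j : ℝ)) :
    ∀ k : ℕ, 2 ≤ k → ∀ ε : ℝ, (ε = 1 ∨ ε = -1) →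
      (Mmat (k * m)
        (-γ / 2 + ε * (1 / 2) * Real.sqrt (2 * σ * m - γ ^ 2 + 2 * (γ ^ 2 - σ) / m))
        σ γ).det ≠ 0 := by
  intro k hk ε hε
  have hm0 : (0 : ℝ) < m := Nat.cast_pos.mpr hm
  have hk2 : (2 : ℝ) ≤ k := by exact_mod_cast hk
  have hD : 0 ≤ 2 * σ * m - γ ^ 2 + 2 * (γ ^ 2 - σ) / m := by
    calc 0 ≤ (2 * σ * (m : ℝ) ^ 2 - γ ^ 2 * m + 2 * (γ ^ 2 - σ)) / m := (div_pos hq hm0).le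
      _ = 2 * σ * m - γ ^ 2 + 2 * (γ ^ 2 - σ) / m := by field_simp
  have hε2 : ε ^ 2 = 1 := by rcases hε with rfl | rfl <;> norm_num
  rw [det_Mmat_mul hm.ne' k]
  swap
  · linear_combination ε ^ 2 / 4 * Real.sq_sqrt hD +
      (2 * σ * m - γ ^ 2 + 2 * (γ ^ 2 - σ) / m) / 4 * hε2
  have hne : γ ^ 2 - σ - k * (σ * (m : ℝ) ^ 2) ≠ 0 := fun h =>
    hno ⟨k, by omega, (div_eq_iff (by positivity)).mpr (sub_eq_zero.mp h)⟩
  have hk0 : (k : ℝ) ≠ 0 := (by linarith : (0 : ℝ) < k).ne'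
  have hk1 : (k : ℝ) - 1 ≠ 0 := (by linarith : (0 : ℝ) < k - 1).ne'
  exact div_ne_zero (neg_ne_zero.mpr
    (mul_ne_zero (mul_ne_zero (mul_ne_zero hk0 hm0.ne') hk1) hne)) two_ne_zero
end

section
/- Let σ > 0, γ ∈ ℝ, and let m be a positive integer with λ² := 2σm - γ² + 2(γ²-σ)/m > 0, where λ := √(2σm - γ² + 2(γ²-σ)/m) > 0. Then for either choice of sign, the kernel of the matrix M_m(c_m^±(σ,γ), σ, γ) is one-dimensional and spanned by the vector (1, ±λ), and the kernel of its transpose is one-dimensional and spanned by the vector (∓λ, 1). -/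
open Matrix
/-- At `c = -γ/2 + l/2`, with `l² = 2σm - γ² + 2(γ²-σ)/m`, the symbol factors through `l`. -/
theorem Mmat_eq_smul {σ γ l : ℝ} {m : ℕ} (hm : 0 < m)
    (hl : l ^ 2 = 2 * σ * m - γ ^ 2 + 2 * (γ ^ 2 - σ) / m) :
    Mmat m (-γ / 2 + l / 2) σ γ = ((m : ℝ) / 2) • !![-l, 1; -l ^ 2, l] := by
  have hm' : (m : ℝ) ≠ 0 := by positivity
  ext i j
  fin_cases i <;> fin_cases j <;> simp [Mmat]
  · ring
  · rw [hl]
    field_simp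
    ring
  · ring

/-- The kernel of `!![-l, 1; -l², l]` is spanned by `(1, l)`. -/
theorem mulVec_eq_zero_iff_exists_smul (l : ℝ) (v : Fin 2 → ℝ) :
    !![-l, 1; -l ^ 2, l] *ᵥ v = 0 ↔ ∃ t : ℝ, v = t • ![1, l] := by
  simp only [funext_iff, Fin.forall_fin_two, Matrix.mulVec, dotProduct, Fin.sum_univ_two]
  simp
  constructor
  · rintro ⟨h, -⟩
    linarith
  · intro h
    rw [h]
    constructor <;> ring

/-- The kernel of the transpose of `!![-l, 1; -l², l]` is spanned by `(-l, 1)`. -/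
theorem transpose_mulVec_eq_zero_iff_exists_smul (l : ℝ) (v : Fin 2 → ℝ) :
    !![-l, 1; -l ^ 2, l]ᵀ *ᵥ v = 0 ↔ ∃ t : ℝ, v = t • ![-l, 1] := by
  simp only [funext_iff, Fin.forall_fin_two, Matrix.mulVec, dotProduct, Fin.sum_univ_two]
  simp
  constructor
  · rintro ⟨-, h⟩
    linarith
  · intro h
    rw [h]
    constructor <;> ring

/-- At the bifurcation speeds `c_m^±(σ,γ) = -γ/2 ± λ/2` with
`λ = √(2σm - γ² + 2(γ²-σ)/m) > 0`, the kernel of `M_m(c_m^±,σ,γ)` is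
one-dimensional, spanned by `(1, ±λ)`, and the kernel of the transpose is
one-dimensional, spanned by `(∓λ, 1)`. -/
theorem kernel_of_Mm_at_cpm (σ γ : ℝ) (hσ : 0 < σ) (m : ℕ) (hm : 0 < m)
    (hlam : 0 < 2 * σ * (m : ℝ) - γ ^ 2 + 2 * (γ ^ 2 - σ) / (m : ℝ)) :
    ∀ ε : ℝ, (ε = 1 ∨ ε = -1) →
      (∀ v : Fin 2 → ℝ,
        (Mmat m (-γ / 2 + ε * (1 / 2) *
            Real.sqrt (2 * σ * m - γ ^ 2 + 2 * (γ ^ 2 - σ) / m)) σ γ).mulVec v = 0 ↔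
          ∃ t : ℝ, v = t • ![1, ε * Real.sqrt (2 * σ * m - γ ^ 2 + 2 * (γ ^ 2 - σ) / m)]) ∧
      (∀ v : Fin 2 → ℝ,
        (Mmat m (-γ / 2 + ε * (1 / 2) *
            Real.sqrt (2 * σ * m - γ ^ 2 + 2 * (γ ^ 2 - σ) / m)) σ γ)ᵀ.mulVec v = 0 ↔
          ∃ t : ℝ, v = t • ![-ε * Real.sqrt (2 * σ * m - γ ^ 2 + 2 * (γ ^ 2 - σ) / m), 1]) := by
  intro ε hε
  set r := Real.sqrt (2 * σ * m - γ ^ 2 + 2 * (γ ^ 2 - σ) / m) with hr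
  have hε2 : ε ^ 2 = 1 := by rcases hε with rfl | rfl <;> norm_num
  have hl : (ε * r) ^ 2 = 2 * σ * m - γ ^ 2 + 2 * (γ ^ 2 - σ) / m := by
    rw [mul_pow, hε2, one_mul, hr, Real.sq_sqrt hlam.le]
  have hm2 : (m : ℝ) / 2 ≠ 0 := by positivity
  rw [show ε * (1 / 2) * r = ε * r / 2 by ring, Mmat_eq_smul hm hl, neg_mul]
  refine ⟨fun v => ?_, fun v => ?_⟩
  · rw [Matrix.smul_mulVec, smul_eq_zero_iff_right hm2, mulVec_eq_zero_iff_exists_smul]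
  · rw [Matrix.transpose_smul, Matrix.smul_mulVec, smul_eq_zero_iff_right hm2,
      transpose_mulVec_eq_zero_iff_exists_smul]
end

section
/- For all real c, σ, γ: det M_1(c,σ,γ) = -c(c+γ), which is independent of σ; and for every integer n ≥ 2 and every σ ∈ ℝ, det M_n(c,σ,γ) = 0 if and only if σ = σ_n(c,γ) := (n((2c+γ)² + γ²) - 2γ²)/(2(n² - 1)). -/
/-- `det M_1(c,σ,γ) = -c(c+γ)` (independent of `σ`), and for `n ≥ 2`,
`det M_n(c,σ,γ) = 0` iff `σ = σ_n(c,γ) = (n((2c+γ)² + γ²) - 2γ²)/(2(n²-1))`. -/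
theorem detM_sigma (c γ : ℝ) :
    (∀ σ : ℝ, (Mmat 1 c σ γ).det = -c * (c + γ)) ∧
    (∀ n : ℕ, 2 ≤ n → ∀ σ : ℝ,
      (Mmat n c σ γ).det = 0 ↔
        σ = ((n : ℝ) * ((2 * c + γ) ^ 2 + γ ^ 2) - 2 * γ ^ 2) / (2 * ((n : ℝ) ^ 2 - 1))) := by
  refine ⟨fun σ => ?_, fun n hn σ => ?_⟩
  · simp only [Mmat, Matrix.det_fin_two_of]
    push_cast
    ring
  · have hn' : (2 : ℝ) ≤ n := by exact_mod_cast hn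
    have hpos : 0 < 2 * ((n : ℝ) ^ 2 - 1) := by nlinarith
    have hdet : (Mmat n c σ γ).det = (n : ℝ) / 4 * (σ * (2 * ((n : ℝ) ^ 2 - 1)) -
        ((n : ℝ) * ((2 * c + γ) ^ 2 + γ ^ 2) - 2 * γ ^ 2)) := by
      simp only [Mmat, Matrix.det_fin_two_of]
      ring
    have hn0 : (n : ℝ) / 4 ≠ 0 := by positivity
    rw [hdet, eq_div_iff hpos.ne', mul_eq_zero, or_iff_right hn0, sub_eq_zero]
end

section
/- Let (c,γ) ∈ ℝ² \ {(0,0)}, and let m ≥ 2 be an integer with m > 2γ²/((2c+γ)² + γ²), and suppose that ((2m-1)γ² - (2c+γ)²)/(m(2c+γ)² + (m-2)γ²) is not a positive integer. Then for every integer k ≥ 2, det M_{km}(c, σ_m(c,γ), γ) ≠ 0. -/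
/-- Absence of spectral collisions for the bifurcation in the surface tension:
if `(c,γ) ≠ (0,0)`, `m ≥ 2`, `m > 2γ²/((2c+γ)²+γ²)`, and
`((2m-1)γ² - (2c+γ)²)/(m(2c+γ)² + (m-2)γ²)` is not a positive integer, then
`det M_{km}(c, σ_m(c,γ), γ) ≠ 0` for every `k ≥ 2`, where
`σ_m(c,γ) = (m((2c+γ)² + γ²) - 2γ²)/(2(m²-1))`. -/
theorem no_spectral_collision_sigma (c γ : ℝ) (hcγ : (c, γ) ≠ (0, 0))
    (m : ℕ) (hm : 2 ≤ m)
    (hmN : 2 * γ ^ 2 / ((2 * c + γ) ^ 2 + γ ^ 2) < (m : ℝ))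
    (hno : ¬ ∃ j : ℕ, 0 < j ∧
      ((2 * (m : ℝ) - 1) * γ ^ 2 - (2 * c + γ) ^ 2) /
        ((m : ℝ) * (2 * c + γ) ^ 2 + ((m : ℝ) - 2) * γ ^ 2) = (j : ℝ)) :
    ∀ k : ℕ, 2 ≤ k →
      (Mmat (k * m) c
        (((m : ℝ) * ((2 * c + γ) ^ 2 + γ ^ 2) - 2 * γ ^ 2) / (2 * ((m : ℝ) ^ 2 - 1)))
        γ).det ≠ 0 := by
  intro k hk hdet
  have hm2 : (2 : ℝ) ≤ m := by exact_mod_cast hm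
  have hk2 : (2 : ℝ) ≤ k := by exact_mod_cast hk
  have hS : 0 < (2 * c + γ) ^ 2 + γ ^ 2 := by
    refine lt_of_le_of_ne (by positivity) fun h => hcγ ?_
    have hγ : γ = 0 := by nlinarith [sq_nonneg (2 * c + γ), sq_nonneg γ]
    subst hγ
    have hc : c = 0 := by nlinarith [sq_nonneg c]
    rw [hc]
  rw [div_lt_iff₀ hS] at hmN
  have hD : 0 < (m : ℝ) * (2 * c + γ) ^ 2 + ((m : ℝ) - 2) * γ ^ 2 := by linarith
  have hm1 : 0 < (m : ℝ) ^ 2 - 1 := by nlinarith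
  refine hno ⟨k * m, by positivity, ?_⟩
  rw [Mmat, Matrix.det_fin_two_of] at hdet
  rw [div_eq_iff hD.ne']
  push_cast at hdet ⊢
  have hkm : (k : ℝ) * m ≠ 0 := by positivity
  have hnm : (k : ℝ) * m - m ≠ 0 := by nlinarith
  field_simp at hdet
  apply mul_left_cancel₀ hkm
  apply mul_left_cancel₀ hnm
  linear_combination -hdet
end

section
/- Let c, γ ∈ ℝ and let m ≥ 2 be an integer. Then the kernel of the matrix M_m(c, σ_m(c,γ), γ) is one-dimensional and spanned by the vector (1, 2c+γ), and the kernel of its transpose is one-dimensional and spanned by the vector (-(2c+γ), 1). -/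
open Matrix

/-- At the critical surface tension the symbol is a nonzero multiple of a nilpotent matrix. -/
theorem Mmat_critical (c γ : ℝ) (m : ℕ) (hm : 2 ≤ m) :
    Mmat m c
        (((m : ℝ) * ((2 * c + γ) ^ 2 + γ ^ 2) - 2 * γ ^ 2) / (2 * ((m : ℝ) ^ 2 - 1))) γ =
      ((m : ℝ) / 2) • !![-(2 * c + γ), 1; -(2 * c + γ) ^ 2, 2 * c + γ] := by
  have hm' : (2 : ℝ) ≤ m := by exact_mod_cast hm
  have h : (m : ℝ) ^ 2 - 1 ≠ 0 := by nlinarith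
  ext i j
  fin_cases i <;> fin_cases j <;> simp [Mmat]
  · ring
  · field_simp
    ring
  · ring

theorem mulVec_nilpotent_eq_zero_iff (a : ℝ) (v : Fin 2 → ℝ) :
    !![-a, 1; -a ^ 2, a] *ᵥ v = 0 ↔ ∃ t : ℝ, v = t • ![1, a] := by
  simp only [funext_iff, Fin.forall_fin_two]
  simp [Matrix.mulVec, dotProduct, Fin.sum_univ_two]
  constructor
  · rintro ⟨h, -⟩
    linarith
  · intro h
    rw [h]
    constructor <;> ring

theorem transpose_mulVec_nilpotent_eq_zero_iff (a : ℝ) (v : Fin 2 → ℝ) :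
    !![-a, 1; -a ^ 2, a]ᵀ *ᵥ v = 0 ↔ ∃ t : ℝ, v = t • ![-a, 1] := by
  simp only [funext_iff, Fin.forall_fin_two]
  simp [Matrix.mulVec, dotProduct, Fin.sum_univ_two]
  constructor
  · rintro ⟨-, h⟩
    linarith
  · intro h
    rw [h]
    constructor <;> ring

/-- At `σ = σ_m(c,γ) = (m((2c+γ)² + γ²) - 2γ²)/(2(m²-1))`, the kernel of
`M_m(c, σ_m(c,γ), γ)` is one-dimensional, spanned by `(1, 2c+γ)`, and the kernel
of its transpose is one-dimensional, spanned by `(-(2c+γ), 1)`. -/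
theorem kernel_of_Mm_at_sigmam (c γ : ℝ) (m : ℕ) (hm : 2 ≤ m) :
    (∀ v : Fin 2 → ℝ,
      (Mmat m c
        (((m : ℝ) * ((2 * c + γ) ^ 2 + γ ^ 2) - 2 * γ ^ 2) / (2 * ((m : ℝ) ^ 2 - 1)))
        γ).mulVec v = 0 ↔ ∃ t : ℝ, v = t • ![1, 2 * c + γ]) ∧
    (∀ v : Fin 2 → ℝ,
      (Mmat m c
        (((m : ℝ) * ((2 * c + γ) ^ 2 + γ ^ 2) - 2 * γ ^ 2) / (2 * ((m : ℝ) ^ 2 - 1)))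
        γ)ᵀ.mulVec v = 0 ↔ ∃ t : ℝ, v = t • ![-(2 * c + γ), 1]) := by
  have hm' : (m : ℝ) / 2 ≠ 0 := by
    have : m ≠ 0 := by lia
    positivity
  rw [Mmat_critical c γ m hm]
  constructor <;> intro v
  · rw [smul_mulVec, smul_eq_zero_iff_right hm', mulVec_nilpotent_eq_zero_iff]
  · rw [transpose_smul, smul_mulVec, smul_eq_zero_iff_right hm',
      transpose_mulVec_nilpotent_eq_zero_iff]
end

section
/- Let σ > 0. Then det M_1(0,σ,γ) = 0 for every γ ∈ ℝ, and for each integer n ≥ 2 and each γ ∈ ℝ, det M_n(0,σ,γ) = 0 if and only if γ = √(σ(n+1)) or γ = -√(σ(n+1)). -/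
/-- At `c = 0` the determinant of the symbol factors. -/
theorem det_Mmat_zero (n : ℕ) (σ γ : ℝ) :
    (Mmat n 0 σ γ).det = -((n : ℝ) * (n - 1) / 2) * (γ ^ 2 - σ * (n + 1)) := by
  rw [Mmat, Matrix.det_fin_two_of]
  ring

/-- For stationary vortex sheets (`c = 0`): `det M_1(0,σ,γ) = 0` for every `γ`,
and for `n ≥ 2`, `det M_n(0,σ,γ) = 0` iff `γ = ±√(σ(n+1))`. -/
theorem detM_gamma (σ : ℝ) (hσ : 0 < σ) :
    (∀ γ : ℝ, (Mmat 1 0 σ γ).det = 0) ∧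
    (∀ n : ℕ, 2 ≤ n → ∀ γ : ℝ,
      (Mmat n 0 σ γ).det = 0 ↔
        γ = Real.sqrt (σ * ((n : ℝ) + 1)) ∨ γ = -Real.sqrt (σ * ((n : ℝ) + 1))) := by
  refine ⟨fun γ => by simp [det_Mmat_zero], fun n hn γ => ?_⟩
  have hn' : (2 : ℝ) ≤ n := by exact_mod_cast hn
  have hcoef : -((n : ℝ) * (n - 1) / 2) ≠ 0 := by nlinarith
  rw [det_Mmat_zero, mul_eq_zero_iff_left hcoef, sub_eq_zero, ← sq_eq_sq_iff_eq_or_eq_neg,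
    Real.sq_sqrt (by positivity)]
end

section
/- For a twice differentiable function η : ℝ → ℝ with 1 + 2η > 0, set R = √(1 + 2η) and define 𝒦(η)(x) = (η''(x) - 2(η'(x)/R(x))²)/(R(x)² + (η'(x)/R(x))²)^{3/2} - (R(x)² + (η'(x)/R(x))²)^{-1/2}. Then for every twice differentiable function η̂ : ℝ → ℝ and every x ∈ ℝ, the map t ↦ 𝒦(tη̂)(x) is differentiable at t = 0 and its derivative there equals η̂(x) + η̂''(x). -/
/-- The curvature functional `𝒦(η)(x)` of the radial graph
`z(x) = √(1+2η(x)) e^{ix}`: with `R = √(1+2η)`,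
`𝒦(η)(x) = (η'' - 2(η'/R)²)/(R² + (η'/R)²)^{3/2} - (R² + (η'/R)²)^{-1/2}`. -/
noncomputable def curv (η : ℝ → ℝ) (x : ℝ) : ℝ :=
  (deriv (deriv η) x - 2 * (deriv η x / Real.sqrt (1 + 2 * η x)) ^ 2) /
      ((Real.sqrt (1 + 2 * η x)) ^ 2 + (deriv η x / Real.sqrt (1 + 2 * η x)) ^ 2)
        ^ ((3 : ℝ) / 2) -
    ((Real.sqrt (1 + 2 * η x)) ^ 2 + (deriv η x / Real.sqrt (1 + 2 * η x)) ^ 2)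
      ^ (-(1 : ℝ) / 2)

/-- Gateaux derivative of the curvature functional at the circular solution
`η = 0`: for every twice differentiable `η̂` and every `x`, the map
`t ↦ 𝒦(tη̂)(x)` is differentiable at `t = 0` with derivative `η̂(x) + η̂''(x)`. -/
theorem curvature_gateaux_derivative_at_zero (ηhat : ℝ → ℝ)
    (h1 : Differentiable ℝ ηhat) (h2 : Differentiable ℝ (deriv ηhat)) (x : ℝ) :
    HasDerivAt (fun t : ℝ => curv (fun y => t * ηhat y) x)
      (ηhat x + deriv (deriv ηhat) x) 0 := by
  set a := ηhat x
  set b := deriv ηhat x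
  set c := deriv (deriv ηhat) x
  have hd (t : ℝ) : deriv (fun y => t * ηhat y) = fun y => t * deriv ηhat y :=
    funext fun y => deriv_const_mul t (h1 y)
  have hdd (t : ℝ) : deriv (deriv (fun y => t * ηhat y)) x = t * c := by
    rw [hd t]
    exact deriv_const_mul t (h2 x)
  have hid : HasDerivAt (fun t : ℝ => t) 1 0 := hasDerivAt_id 0
  have hR : HasDerivAt (fun t : ℝ => Real.sqrt (1 + 2 * (t * a))) a 0 := by
    have h := (((hid.mul_const a).const_mul 2).const_add 1).sqrt (by simp)
    exact h.congr_deriv (by simp)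
  have hq : HasDerivAt (fun t : ℝ => (t * b / Real.sqrt (1 + 2 * (t * a))) ^ 2) 0 0 := by
    have h := ((hid.mul_const b).fun_div hR (by simp)).fun_pow 2
    exact h.congr_deriv (by simp)
  have hS : HasDerivAt (fun t : ℝ => Real.sqrt (1 + 2 * (t * a)) ^ 2 +
      (t * b / Real.sqrt (1 + 2 * (t * a))) ^ 2) (2 * a) 0 := by
    have h := (hR.fun_pow 2).fun_add hq
    exact h.congr_deriv (by simp)
  have hN : HasDerivAt (fun t : ℝ => t * c -
      2 * (t * b / Real.sqrt (1 + 2 * (t * a))) ^ 2) c 0 := by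
    have h := (hid.mul_const c).fun_sub (hq.const_mul 2)
    exact h.congr_deriv (by simp)
  have h := (hN.fun_div (hS.rpow_const (p := (3 : ℝ) / 2) (by simp)) (by simp)).fun_sub
    (hS.rpow_const (p := -(1 : ℝ) / 2) (by simp))
  have hcurv : (fun t : ℝ => curv (fun y => t * ηhat y) x) = fun t : ℝ =>
      (t * c - 2 * (t * b / Real.sqrt (1 + 2 * (t * a))) ^ 2) /
        (Real.sqrt (1 + 2 * (t * a)) ^ 2 +
          (t * b / Real.sqrt (1 + 2 * (t * a))) ^ 2) ^ ((3 : ℝ) / 2) -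
      (Real.sqrt (1 + 2 * (t * a)) ^ 2 +
        (t * b / Real.sqrt (1 + 2 * (t * a))) ^ 2) ^ (-(1 : ℝ) / 2) := by
    funext t
    rw [curv, hdd t, hd t]
  rw [hcurv]
  refine h.congr_deriv ?_
  simp
  ring
end
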